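/- For every network N = (G, d, S, T) with edge set E and every n ≥ 1, the one-shot tensor-network capacity of the n-th power network satisfies the two-sided bound 2^(−|E|) · MC(N)^n ≤ R1(N^⊠n) ≤ MC(N)^n (the first inequality taken in ℝ, i.e. 2^|E| · R1(N^⊠n) ≥ MC(N)^n). -/

import Mathlib

/-- A finite undirected multigraph without self-loops, together with disjoint
nonempty sets of source and sink vertices, in which every edge has at least
one internal endpoint (an internal vertex is one that is neither a source
nor a sink). Dimension functions on the edges are kept separate. -/
structure NetShape where
  V : Type
  E : Type
  [fintypeV : Fintype V]
  [fintypeE : Fintype E]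
  [decEqV : DecidableEq V]
  [decEqE : DecidableEq E]
  /-- the two endpoints of each edge -/
  ends : E → V × V
  no_loops : ∀ e, (ends e).1 ≠ (ends e).2
  /-- the set of source vertices -/
  S : Finset V
  /-- the set of sink vertices -/
  T : Finset V
  S_nonempty : S.Nonempty
  T_nonempty : T.Nonempty
  ST_disjoint : Disjoint S T
  /-- every edge has at least one internal endpoint -/
  edge_internal : ∀ e, ((ends e).1 ∉ S ∧ (ends e).1 ∉ T) ∨ ((ends e).2 ∉ S ∧ (ends e).2 ∉ T)

attribute [instance] NetShape.fintypeV NetShape.fintypeE NetShape.decEqV NetShape.decEqE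

namespace NetShape

variable (G : NetShape)

/-- A vertex is internal if it is neither a source nor a sink. -/
def Internal (v : G.V) : Prop := v ∉ G.S ∧ v ∉ G.T

instance : DecidablePred G.Internal := fun _ => instDecidableAnd

/-- `e` is incident to `v` if `v` is one of its endpoints. -/
def Incident (v : G.V) (e : G.E) : Prop := (G.ends e).1 = v ∨ (G.ends e).2 = v

instance (v : G.V) : DecidablePred (G.Incident v) := fun _ => instDecidableOr

/-- A source edge: one of its endpoints is a source. -/
def IsSourceEdge (e : G.E) : Prop := (G.ends e).1 ∈ G.S ∨ (G.ends e).2 ∈ G.S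

/-- A sink edge: one of its endpoints is a sink. -/
def IsSinkEdge (e : G.E) : Prop := (G.ends e).1 ∈ G.T ∨ (G.ends e).2 ∈ G.T

/-- An internal edge: both endpoints are internal, i.e. it is neither a source
edge nor a sink edge. -/
def IsInternalEdge (e : G.E) : Prop := ¬ G.IsSourceEdge e ∧ ¬ G.IsSinkEdge e

instance : DecidablePred G.IsSourceEdge := fun _ => instDecidableOr
instance : DecidablePred G.IsSinkEdge := fun _ => instDecidableOr
instance : DecidablePred G.IsInternalEdge := fun _ => instDecidableAnd

/-- A tensor assignment for the dimension function `d`: each internal vertex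
`u` carries a tensor with one index of size `d e` for each edge `e` incident
to `u`. -/
def TensorAssignment (d : G.E → ℕ) : Type :=
  ∀ u : {v : G.V // G.Internal v},
    ((e : {e : G.E // G.Incident u.1 e}) → Fin (d e.1)) → ℂ

/-- Combine index assignments on source, sink and internal edges into an index
assignment on all edges. -/
def fullIndex (d : G.E → ℕ)
    (a : (e : {e : G.E // G.IsSourceEdge e}) → Fin (d e.1))
    (b : (e : {e : G.E // G.IsSinkEdge e}) → Fin (d e.1))
    (c : (e : {e : G.E // G.IsInternalEdge e}) → Fin (d e.1))
    (e : G.E) : Fin (d e) :=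
  if h : G.IsSourceEdge e then a ⟨e, h⟩
  else if h' : G.IsSinkEdge e then b ⟨e, h'⟩
  else c ⟨e, ⟨h, h'⟩⟩

/-- The contraction of the tensor network: the matrix `β_𝒯`, with rows indexed
by the indices of the sink edges and columns by the indices of the source
edges, obtained by summing over all indices of the internal edges the product
over internal vertices of the corresponding tensor entries. -/
noncomputable def contraction (d : G.E → ℕ) (𝒯 : G.TensorAssignment d) :
    Matrix ((e : {e : G.E // G.IsSinkEdge e}) → Fin (d e.1))
           ((e : {e : G.E // G.IsSourceEdge e}) → Fin (d e.1)) ℂ :=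
  fun b a =>
    ∑ c : (e : {e : G.E // G.IsInternalEdge e}) → Fin (d e.1),
      ∏ u : {v : G.V // G.Internal v},
        𝒯 u (fun e => G.fullIndex d a b c e.1)

/-- The one-shot tensor-network capacity: the maximal rank of the contraction
over all tensor assignments. -/
noncomputable def R1 (d : G.E → ℕ) : ℕ :=
  sSup { r | ∃ 𝒯 : G.TensorAssignment d, (G.contraction d 𝒯).rank = r }

/-- A cut, given by the source side `A`: it contains all sources and no sinks
(the sink side is the complement of `A`). -/
def IsCut (A : Finset G.V) : Prop := G.S ⊆ A ∧ ∀ v ∈ G.T, v ∉ A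

/-- An edge crosses the cut with source side `A` if exactly one of its
endpoints lies in `A`. -/
def Crosses (A : Finset G.V) (e : G.E) : Prop :=
  ((G.ends e).1 ∈ A ∧ (G.ends e).2 ∉ A) ∨ ((G.ends e).1 ∉ A ∧ (G.ends e).2 ∈ A)

instance (A : Finset G.V) : DecidablePred (G.Crosses A) := fun _ => instDecidableOr

/-- The value of a cut: the product of the dimensions of the crossing edges. -/
def cutValue (d : G.E → ℕ) (A : Finset G.V) : ℕ :=
  ∏ e ∈ Finset.univ.filter (G.Crosses A), d e

/-- The min-cut: the minimum cut value over all cuts. -/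
noncomputable def MC (d : G.E → ℕ) : ℕ :=
  sInf { w | ∃ A : Finset G.V, G.IsCut A ∧ G.cutValue d A = w }

end NetShape

/-- The steps of the relation `D` that stay inside the set `C`. -/
def StepIn {X : Type*} (D : X → X → Prop) (C : Set X) (u v : X) : Prop :=
  D u v ∧ u ∈ C ∧ v ∈ C

/-- `b` is reachable from `a` by a walk along `D` all of whose vertices lie in `C`. -/
def ReachIn {X : Type*} (D : X → X → Prop) (C : Set X) (a b : X) : Prop :=
  a ∈ C ∧ Relation.ReflTransGen (StepIn D C) a b

namespace ReachIn

variable {X : Type*} {D D' : X → X → Prop} {C C' : Set X} {a b c : X}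

theorem refl (h : a ∈ C) : ReachIn D C a a := ⟨h, .refl⟩

theorem mem_right (h : ReachIn D C a b) : b ∈ C := by
  obtain ⟨ha, h⟩ := h
  cases h with
  | refl => exact ha
  | tail _ h => exact h.2.2

theorem trans (h : ReachIn D C a b) (h' : ReachIn D C b c) : ReachIn D C a c :=
  ⟨h.1, h.2.trans h'.2⟩

theorem tail (h : ReachIn D C a b) (h' : D b c) (hc : c ∈ C) : ReachIn D C a c :=
  ⟨h.1, h.2.tail ⟨h', h.mem_right, hc⟩⟩

theorem mono (hD : ∀ u v, D u v → D' u v) (hC : C ⊆ C') (h : ReachIn D C a b) :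
    ReachIn D' C' a b :=
  ⟨hC h.1, Relation.ReflTransGen.mono
    (fun u v huv => ⟨hD u v huv.1, hC huv.2.1, hC huv.2.2⟩) _ _ h.2⟩

theorem swap (h : ReachIn D C a b) : ReachIn (Function.swap D) C b a := by
  refine ⟨h.mem_right, ?_⟩
  exact Relation.ReflTransGen.mono (fun u v huv => ⟨huv.1, huv.2.2, huv.2.1⟩) _ _ h.2.swap

theorem induction_right {P : X → Prop} (h : ReachIn D C a b) (h0 : P a)
    (hs : ∀ u v, ReachIn D C a u → D u v → v ∈ C → P u → P v) : P b := by
  obtain ⟨ha, h⟩ := h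
  induction h with
  | refl => exact h0
  | tail hu huv ih => exact hs _ _ ⟨ha, hu⟩ huv.1 huv.2.2 ih

end ReachIn

/-- `W` meets every walk along `D` from `A` to `B`. -/
def Separates {X : Type*} (D : X → X → Prop) (A B W : Set X) : Prop :=
  ∀ a ∈ A, ∀ b ∈ B, ¬ ReachIn D Wᶜ a b

/-- The index type `I` labels disjoint vertex sets, each containing a walk from `A` to `B`. -/
def Linked {X : Type*} (D : X → X → Prop) (A B : Set X) (I : Type*) : Prop :=
  ∃ C : I → Set X, (∀ i j v, v ∈ C i → v ∈ C j → i = j) ∧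
    ∀ i, ∃ a ∈ A, ∃ b ∈ B, ReachIn D (C i) a b

section Menger

variable {X : Type*} {D D' : X → X → Prop} {A B W : Set X}

theorem Separates.swap (h : Separates D A B W) : Separates (Function.swap D) B A W :=
  fun b hb a ha hba => h a ha b hb hba.swap

theorem Linked.swap {I : Type*} (h : Linked D A B I) : Linked (Function.swap D) B A I := by
  obtain ⟨C, hC, h⟩ := h
  refine ⟨C, hC, fun i => ?_⟩
  obtain ⟨a, ha, b, hb, hab⟩ := h i
  exact ⟨b, hb, a, ha, hab.swap⟩

theorem Linked.mono {I : Type*} (hD : ∀ u v, D u v → D' u v) (h : Linked D A B I) :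
    Linked D' A B I := by
  obtain ⟨C, hC, h⟩ := h
  refine ⟨C, hC, fun i => ?_⟩
  obtain ⟨a, ha, b, hb, hab⟩ := h i
  exact ⟨a, ha, b, hb, hab.mono hD subset_rfl⟩

/-- If all steps of `D` missing from `D'` start at `x`, and `W` separates `A` from `B` in `D'`,
then whatever separates `A` from `insert x W` in `D'` separates `A` from `B` in `D`. -/
theorem Separates.of_insert {x : X} {U : Set X} (hW : Separates D' A B W)
    (hD : ∀ u v, D u v → u ≠ x → D' u v) (hU : Separates D' A (insert x W) U) :
    Separates D A B U := by
  intro a ha b hb hab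
  have key : ReachIn D' (insert x W)ᶜ a b := by
    refine hab.induction_right (P := fun v => ReachIn D' (Uᶜ ∩ (insert x W)ᶜ) a v) ?_ ?_
      |>.mono (fun _ _ h => h) Set.inter_subset_right
    · exact .refl ⟨hab.1, fun h => hU a ha a h (.refl hab.1)⟩
    · intro u v _ huv hv ih
      have huv' : D' u v := hD u v huv fun h => ih.mem_right.2 (Set.mem_insert_iff.2 (.inl h))
      refine ih.tail huv' ⟨hv, fun h => ?_⟩
      exact hU a ha v h ((ih.mono (fun _ _ h => h) Set.inter_subset_left).tail huv' hv)
  exact hW a ha b hb (key.mono (fun _ _ h => h) (Set.compl_subset_compl.2 (Set.subset_insert x W)))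

/-- A linkage from `A` onto `insert x W` can be indexed by its endpoints, and pruned so that it
only uses vertices reachable from `A` without passing through `W`. -/
theorem Linked.exists_pruned {x : X} {W : Finset X} {k : ℕ}
    (h : Linked D A (insert x (W : Set X)) (Fin k)) (hk : W.card + 1 ≤ k) :
    W.card + 1 = k ∧ ∃ C : Option W → Set X, (∀ i j v, v ∈ C i → v ∈ C j → i = j) ∧
      (∀ i, ∃ a ∈ A, ReachIn D (C i) a (i.elim x Subtype.val)) ∧
      ∀ i, ∀ v ∈ C i, v ∉ W → ∃ a ∈ A, ReachIn D (W : Set X)ᶜ a v := by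
  classical
  obtain ⟨C, hC, h⟩ := h
  choose a ha b hb hab using h
  have hend : ∀ i, ∃ o : Option W, o.elim x Subtype.val = b i := by
    intro i
    rcases hb i with h | h
    · exact ⟨none, h.symm⟩
    · exact ⟨some ⟨b i, h⟩, rfl⟩
  choose o ho using hend
  have hinj : Function.Injective o := by
    intro i j hij
    refine hC i j (b i) (hab i).mem_right ?_
    rw [← ho i, hij, ho j]
    exact (hab j).mem_right
  have hcard : W.card + 1 = k :=
    le_antisymm hk (by simpa using Fintype.card_le_of_injective o hinj)
  have hbij : Function.Bijective o :=
    (Fintype.bijective_iff_injective_and_card o).2 ⟨hinj, by simp [hcard]⟩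
  let e := Equiv.ofBijective o hbij
  have hbe : ∀ i, b (e.symm i) = i.elim x Subtype.val := by
    intro i
    rw [← ho (e.symm i)]
    exact congrArg (fun o : Option W => o.elim x Subtype.val) (e.apply_symm_apply i)
  let R : Set X := {v | v ∉ W → ∃ a ∈ A, ReachIn D (W : Set X)ᶜ a v}
  refine ⟨hcard, fun i => C (e.symm i) ∩ R, ?_, ?_, fun i v hv => hv.2⟩
  · intro i j v hi hj
    exact e.symm.injective (hC _ _ v hi.1 hj.1)
  · intro i
    refine ⟨a (e.symm i), ha _, ?_⟩
    have haR : a (e.symm i) ∈ R := fun hW => ⟨_, ha _, .refl hW⟩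
    have key := (hab (e.symm i)).induction_right
      (P := fun v => ReachIn D (C (e.symm i) ∩ R) (a (e.symm i)) (b (e.symm i)) ∨
        ReachIn D (C (e.symm i) ∩ R) (a (e.symm i)) v)
      (.inr (.refl ⟨(hab _).1, haR⟩)) (by
        rintro u v hu huv hv (ih | ih)
        · exact .inl ih
        by_cases huW : u ∈ W
        · left
          have h1 : some ⟨u, huW⟩ = i := by
            refine e.symm.injective (hC _ _ u ?_ hu.mem_right)
            have := (hab (e.symm (some ⟨u, huW⟩))).mem_right
            rwa [hbe] at this
          rw [hbe, ← h1]
          rw [← h1] at ih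
          exact ih
        · right
          refine ih.tail huv ⟨hv, fun hvW => ?_⟩
          obtain ⟨a', ha', h'⟩ := ih.mem_right.2 huW
          exact ⟨a', ha', h'.tail huv hvW⟩)
    rw [← hbe]
    exact key.elim id id

/-- **Menger's theorem** for vertex sets in a finite directed graph. -/
theorem linked_of_forall_separates [Finite X] (k : ℕ) (A B : Set X)
    (h : ∀ W : Finset X, Separates D A B W → k ≤ W.card) : Linked D A B (Fin k) := by
  classical
  have := Fintype.ofFinite X
  suffices H : ∀ (m : ℕ) (F : Finset (X × X)), F.card = m → ∀ A B : Set X,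
      (∀ W : Finset X, Separates (fun u v => (u, v) ∈ F) A B W → k ≤ W.card) →
      Linked (fun u v => (u, v) ∈ F) A B (Fin k) by
    simpa using H _ (Finset.univ.filter fun p : X × X => D p.1 p.2) rfl A B (by simpa using h)
  intro m
  induction m with
  | zero =>
    intro F hF A B h
    obtain rfl := Finset.card_eq_zero.1 hF
    have hk : k ≤ (A ∩ B).toFinset.card := by
      refine h _ fun a ha b hb hab => ?_
      have : b = a := hab.induction_right (P := fun v => v = a) rfl (by simp)
      subst this
      exact hab.1 (by simp [ha, hb])
    obtain ⟨f⟩ : Nonempty (Fin k ↪ (A ∩ B).toFinset) :=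
      Function.Embedding.nonempty_of_card_le <| by
        simpa only [Fintype.card_fin, Fintype.card_coe] using hk
    have hf : ∀ i, (f i : X) ∈ A ∩ B := fun i => Set.mem_toFinset.1 (f i).2
    refine ⟨fun i => {(f i : X)}, ?_, fun i => ⟨f i, (hf i).1, f i, (hf i).2, .refl rfl⟩⟩
    rintro i j v rfl hv
    exact f.injective (Subtype.ext hv)
  | succ m ih =>
    intro F hF A B h
    obtain ⟨⟨x, y⟩, hxy⟩ : F.Nonempty := Finset.card_pos.1 (by omega)
    have hF' : (F.erase (x, y)).card = m := by rw [Finset.card_erase_of_mem hxy]; omega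
    by_cases h' : ∀ W : Finset X,
        Separates (fun u v => (u, v) ∈ F.erase (x, y)) A B W → k ≤ W.card
    · exact (ih _ hF' A B h').mono fun u v huv => Finset.mem_of_mem_erase huv
    push Not at h'
    obtain ⟨W, hW, hWk⟩ := h'
    have hA := ih _ hF' A (insert x (W : Set X)) fun U hU => h U <| hW.of_insert
      (fun u v huv hux => Finset.mem_erase.2 ⟨fun h => hux (congrArg Prod.fst h), huv⟩) hU
    have hB := ih _ hF' (insert y (W : Set X)) B fun U hU => h U <| (hW.swap.of_insert (x := y)
      (D := Function.swap fun u v => (u, v) ∈ F)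
      (fun u v huv hux => Finset.mem_erase.2 ⟨fun h => hux (congrArg Prod.snd h), huv⟩)
      hU.swap).swap
    obtain ⟨hcard, C, hC, hCr, hCp⟩ := hA.exists_pruned hWk
    obtain ⟨-, C', hC', hCr', hCp'⟩ := hB.swap.exists_pruned hWk
    have hmem : ∀ w : W, (w : X) ∈ C (some w) := fun w => (hCr (some w)).choose_spec.2.mem_right
    have hmem' : ∀ w : W, (w : X) ∈ C' (some w) := fun w => (hCr' (some w)).choose_spec.2.mem_right
    have hcross : ∀ i j v, v ∈ C i → v ∈ C' j → i = j := by
      intro i j v hi hj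
      by_cases hv : v ∈ W
      · exact (hC _ _ v hi (hmem ⟨v, hv⟩)).trans (hC' _ _ v (hmem' ⟨v, hv⟩) hj)
      · obtain ⟨a, ha, hav⟩ := hCp i v hi hv
        obtain ⟨b, hb, hbv⟩ := hCp' j v hj hv
        exact (hW a ha b hb (hav.trans hbv.swap)).elim
    obtain ⟨f⟩ : Nonempty (Fin k ↪ Option W) :=
      Function.Embedding.nonempty_of_card_le (by simp [hcard])
    refine ⟨fun i => C (f i) ∪ C' (f i), ?_, fun i => ?_⟩
    · rintro i j v (hi | hi) (hj | hj) <;> apply f.injective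
      · exact hC _ _ v hi hj
      · exact hcross _ _ v hi hj
      · exact (hcross _ _ v hj hi).symm
      · exact hC' _ _ v hi hj
    · obtain ⟨a, ha, har⟩ := hCr (f i)
      obtain ⟨b, hb, hbr⟩ := hCr' (f i)
      refine ⟨a, ha, b, hb, ?_⟩
      have h1 := har.mono (D' := fun u v => (u, v) ∈ F) (C' := C (f i) ∪ C' (f i))
        (fun _ _ h => Finset.mem_of_mem_erase h) Set.subset_union_left
      have h2 := hbr.swap.mono (D' := fun u v => (u, v) ∈ F) (C' := C (f i) ∪ C' (f i))
        (fun _ _ h => Finset.mem_of_mem_erase h) Set.subset_union_right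
      change ReachIn _ (C (f i) ∪ C' (f i)) a b
      generalize f i = o at h1 h2 ⊢
      cases o with
      | none =>
        exact (h1.tail hxy h2.1).trans h2
      | some w =>
        exact h1.trans h2

end Menger

namespace NetShape

section Capacity

variable {G : NetShape} {D : G.E → ℕ}

theorem rank_le_R1 (𝒯 : G.TensorAssignment D) : (G.contraction D 𝒯).rank ≤ G.R1 D := by
  refine le_csSup ⟨Fintype.card (∀ e : {e : G.E // G.IsSourceEdge e}, Fin (D e.1)), ?_⟩ ⟨𝒯, rfl⟩
  rintro _ ⟨𝒯, rfl⟩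
  exact Matrix.rank_le_card_width _

theorem R1_le {m : ℕ} (h : ∀ 𝒯 : G.TensorAssignment D, (G.contraction D 𝒯).rank ≤ m) :
    G.R1 D ≤ m := by
  refine csSup_le' ?_
  rintro _ ⟨𝒯, rfl⟩
  exact h 𝒯

theorem isCut_S : G.IsCut G.S :=
  ⟨subset_rfl, fun _ hT hS => Finset.disjoint_left.1 G.ST_disjoint hS hT⟩

theorem MC_le {A : Finset G.V} (hA : G.IsCut A) : G.MC D ≤ G.cutValue D A :=
  Nat.sInf_le ⟨A, hA, rfl⟩

theorem exists_cutValue_eq_MC (D : G.E → ℕ) : ∃ A, G.IsCut A ∧ G.cutValue D A = G.MC D :=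
  Nat.sInf_mem (s := {w | ∃ A : Finset G.V, G.IsCut A ∧ G.cutValue D A = w}) ⟨_, G.S, isCut_S, rfl⟩

theorem cutValue_pow (d : G.E → ℕ) (n : ℕ) (A : Finset G.V) :
    G.cutValue (fun e => d e ^ n) A = G.cutValue d A ^ n :=
  Finset.prod_pow _ _ _

theorem IsSourceEdge.not_isSinkEdge {e : G.E} (h : G.IsSourceEdge e) : ¬ G.IsSinkEdge e := by
  have hST := Finset.disjoint_left.1 G.ST_disjoint
  have := G.edge_internal e
  have h1 := @hST (G.ends e).1
  have h2 := @hST (G.ends e).2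
  unfold IsSourceEdge at h
  unfold IsSinkEdge
  tauto

theorem Incident.exists_end {v : G.V} {e : G.E} (h : G.Incident v e) {P : G.V → Prop} (hv : P v) :
    P (G.ends e).1 ∨ P (G.ends e).2 := by
  rcases h with rfl | rfl
  · exact .inl hv
  · exact .inr hv

theorem fullIndex_source (a b c) {e : G.E} (h : G.IsSourceEdge e) :
    G.fullIndex D a b c e = a ⟨e, h⟩ := dif_pos h

theorem fullIndex_sink (a b c) {e : G.E} (h : G.IsSinkEdge e) :
    G.fullIndex D a b c e = b ⟨e, h⟩ := by
  rw [fullIndex, dif_neg fun h' => h'.not_isSinkEdge h, dif_pos h]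

theorem fullIndex_internal (a b c) {e : G.E} (h : G.IsInternalEdge e) :
    G.fullIndex D a b c e = c ⟨e, h⟩ := by
  rw [fullIndex, dif_neg h.1, dif_neg h.2]

theorem fullIndex_restrict (i : ∀ e, Fin (D e)) :
    G.fullIndex D (fun e => i e.1) (fun e => i e.1) (fun e => i e.1) = i := by
  funext e
  unfold fullIndex
  split_ifs <;> rfl

/-- The contraction as a sum over index assignments on all edges. -/
theorem contraction_apply (𝒯 : G.TensorAssignment D) (b a) :
    G.contraction D 𝒯 b a = ∑ i : (∀ e, Fin (D e)),
      if (∀ e : {e // G.IsSourceEdge e}, i e.1 = a e) ∧ (∀ e : {e // G.IsSinkEdge e}, i e.1 = b e)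
      then ∏ u, 𝒯 u (fun e => i e.1) else 0 := by
  rw [← Finset.sum_filter, contraction]
  refine Finset.sum_bij' (fun c _ => G.fullIndex D a b c) (fun i _ e => i e.1) ?_ ?_ ?_ ?_ ?_
  · intro c _
    simp only [Finset.mem_filter, Finset.mem_univ, true_and]
    exact ⟨fun e => fullIndex_source _ _ _ e.2, fun e => fullIndex_sink _ _ _ e.2⟩
  · simp
  · intro c _
    funext e
    exact fullIndex_internal _ _ _ e.2
  · intro i hi
    simp only [Finset.mem_filter, Finset.mem_univ, true_and] at hi
    obtain ⟨ha, hb⟩ := hi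
    obtain rfl : (fun e : {e // G.IsSourceEdge e} => i e.1) = a := funext ha
    obtain rfl : (fun e : {e // G.IsSinkEdge e} => i e.1) = b := funext hb
    exact fullIndex_restrict i
  · intro c _
    rfl

end Capacity

end NetShape

/-- A matrix whose entries are sums over `X × Y × Z` of products of a factor not depending on `Y`
and a factor not depending on `Z` has rank at most the cardinality of `X`. -/
theorem Matrix.rank_le_card_of_eq_sum {K A B X Y Z : Type*} [Field K] [Fintype A] [Fintype X]
    [Fintype Y] [Fintype Z] (M : Matrix B A K) (g : B → X → Z → K) (h : A → X → Y → K)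
    (hM : ∀ b a, M b a = ∑ p : X × Y × Z, g b p.1 p.2.2 * h a p.1 p.2.1) :
    M.rank ≤ Fintype.card X := by
  have : M = Matrix.of (fun b x => ∑ z, g b x z) * Matrix.of (fun x a => ∑ y, h a x y) := by
    ext b a
    rw [hM, Fintype.sum_prod_type, Matrix.mul_apply]
    refine Finset.sum_congr rfl fun x _ => ?_
    simp only [Matrix.of_apply]
    rw [Finset.sum_mul_sum, Finset.sum_comm, Fintype.sum_prod_type]
  rw [this]
  exact (Matrix.rank_mul_le_left _ _).trans (Matrix.rank_le_card_width _)

namespace NetShape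

variable {G : NetShape} {D : G.E → ℕ}

theorem rank_contraction_le_cutValue (hD : ∀ e, 0 < D e) (𝒯 : G.TensorAssignment D)
    {A : Finset G.V} (hA : G.IsCut A) : (G.contraction D 𝒯).rank ≤ G.cutValue D A := by
  classical
  let ε : (∀ e, Fin (D e)) ≃ (∀ e : {e // G.Crosses A e}, Fin (D e)) ×
      (∀ e : {e : {e // ¬ G.Crosses A e} // (G.ends e.1).1 ∈ A}, Fin (D e.1)) ×
      (∀ e : {e : {e // ¬ G.Crosses A e} // ¬ (G.ends e.1).1 ∈ A}, Fin (D e.1)) :=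
    (Equiv.piEquivPiSubtypeProd (G.Crosses A) fun e => Fin (D e)).trans <|
      (Equiv.refl _).prodCongr <| Equiv.piEquivPiSubtypeProd
        (fun e : {e // ¬ G.Crosses A e} => (G.ends e.1).1 ∈ A) fun e => Fin (D e.1)
  have hleft : ∀ x y y' z e, ((G.ends e).1 ∉ A ∨ (G.ends e).2 ∉ A) →
      ε.symm (x, y, z) e = ε.symm (x, y', z) e := by
    intro x y y' z e he
    by_cases hc : G.Crosses A e
    · simp [ε, Equiv.piEquivPiSubtypeProd, hc]
    · have h1 : (G.ends e).1 ∉ A := by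
        unfold Crosses at hc
        tauto
      simp [ε, Equiv.piEquivPiSubtypeProd, hc, h1]
  have hright : ∀ x y z z' e, ((G.ends e).1 ∈ A ∨ (G.ends e).2 ∈ A) →
      ε.symm (x, y, z) e = ε.symm (x, y, z') e := by
    intro x y z z' e he
    by_cases hc : G.Crosses A e
    · simp [ε, Equiv.piEquivPiSubtypeProd, hc]
    · have h1 : (G.ends e).1 ∈ A := by
        unfold Crosses at hc
        tauto
      simp [ε, Equiv.piEquivPiSubtypeProd, hc, h1]
  let y₀ : ∀ e : {e : {e // ¬ G.Crosses A e} // (G.ends e.1).1 ∈ A}, Fin (D e.1) :=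
    fun e => ⟨0, hD _⟩
  let z₀ : ∀ e : {e : {e // ¬ G.Crosses A e} // ¬ (G.ends e.1).1 ∈ A}, Fin (D e.1) :=
    fun e => ⟨0, hD _⟩
  have key := Matrix.rank_le_card_of_eq_sum (G.contraction D 𝒯)
    (fun b x z => (if ∀ e : {e // G.IsSinkEdge e}, ε.symm (x, y₀, z) e.1 = b e then 1 else 0) *
      ∏ u with ¬ u.1 ∈ A, 𝒯 u (fun e => ε.symm (x, y₀, z) e.1))
    (fun a x y => (if ∀ e : {e // G.IsSourceEdge e}, ε.symm (x, y, z₀) e.1 = a e then 1 else 0) *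
      ∏ u with u.1 ∈ A, 𝒯 u (fun e => ε.symm (x, y, z₀) e.1)) ?_
  · refine key.trans (le_of_eq ?_)
    rw [Fintype.card_pi, cutValue, ← Finset.prod_subtype_eq_prod_filter]
    simp
  · intro b a
    rw [contraction_apply, ← ε.symm.sum_comp]
    refine Finset.sum_congr rfl ?_
    rintro ⟨x, y, z⟩ -
    dsimp only
    have h1 : ∀ e : {e // G.IsSinkEdge e}, ε.symm (x, y₀, z) e.1 = ε.symm (x, y, z) e.1 := by
      rintro ⟨e, he⟩
      exact hleft _ _ _ _ _ (he.imp (hA.2 _) (hA.2 _))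
    have h2 : ∀ e : {e // G.IsSourceEdge e}, ε.symm (x, y, z₀) e.1 = ε.symm (x, y, z) e.1 := by
      rintro ⟨e, he⟩
      exact hright _ _ _ _ _ (he.imp (fun h => hA.1 h) (fun h => hA.1 h))
    have h3 : ∏ u with ¬ u.1 ∈ A, 𝒯 u (fun e => ε.symm (x, y₀, z) e.1) =
        ∏ u with ¬ u.1 ∈ A, 𝒯 u (fun e => ε.symm (x, y, z) e.1) := by
      refine Finset.prod_congr rfl fun u hu => congrArg (𝒯 u) (funext fun e => ?_)
      exact hleft _ _ _ _ _ (Incident.exists_end e.2 (P := (· ∉ A)) (Finset.mem_filter.1 hu).2)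
    have h4 : ∏ u with u.1 ∈ A, 𝒯 u (fun e => ε.symm (x, y, z₀) e.1) =
        ∏ u with u.1 ∈ A, 𝒯 u (fun e => ε.symm (x, y, z) e.1) := by
      refine Finset.prod_congr rfl fun u hu => congrArg (𝒯 u) (funext fun e => ?_)
      exact hright _ _ _ _ _ (Incident.exists_end e.2 (P := (· ∈ A)) (Finset.mem_filter.1 hu).2)
    simp only [h1, h2, h3, h4]
    rw [← Finset.prod_filter_mul_prod_filter_not Finset.univ
      (fun u : {v // G.Internal v} => u.1 ∈ A)]
    rw [mul_mul_mul_comm, ite_zero_mul_ite_zero, mul_one, ite_mul, one_mul, zero_mul,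
      mul_comm (∏ u with ¬ u.1 ∈ A, 𝒯 u fun e => ε.symm (x, y, z) e.1)]
    exact if_congr and_comm rfl rfl

/-- Two slots (edges with a multiplicity label) are adjacent if their edges share an internal
vertex. -/
def SlotAdj (G : NetShape) (k : G.E → ℕ) (p q : Σ e, Fin (k e)) : Prop :=
  ∃ u, G.Internal u ∧ G.Incident u p.1 ∧ G.Incident u q.1

theorem linked_slotAdj {k : G.E → ℕ} {f : ℕ}
    (h : ∀ A, G.IsCut A → f ≤ ∑ e with G.Crosses A e, k e) :
    Linked (G.SlotAdj k) {p | G.IsSourceEdge p.1} {p | G.IsSinkEdge p.1} (Fin f) := by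
  classical
  refine linked_of_forall_separates f _ _ fun W hW => ?_
  let R : Set (Σ e, Fin (k e)) :=
    {p | ∃ a, G.IsSourceEdge a.1 ∧ ReachIn (G.SlotAdj k) (W : Set _)ᶜ a p}
  let A : Finset G.V := Finset.univ.filter fun v =>
    v ∈ G.S ∨ (G.Internal v ∧ ∃ p ∈ R, G.Incident v p.1)
  have hA : G.IsCut A := by
    refine ⟨fun v hv => by simp [A, hv], fun v hv => ?_⟩
    have hS : v ∉ G.S := fun h => Finset.disjoint_left.1 G.ST_disjoint h hv
    simp [A, hS, Internal, hv]
  have hR : ∀ p ∈ R, ¬ G.IsSinkEdge p.1 := fun p ⟨a, ha, hap⟩ hp => hW a ha p hp hap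
  have hstart : ∀ p : Σ e, Fin (k e), p ∉ W → G.IsSourceEdge p.1 → p ∈ R :=
    fun p hp hs => ⟨p, hs, .refl hp⟩
  have hstep : ∀ p : Σ e, Fin (k e), p ∉ W → ∀ v ∈ A, G.Incident v p.1 → p ∈ R := by
    intro p hp v hv hvp
    simp only [A, Finset.mem_filter, Finset.mem_univ, true_and] at hv
    rcases hv with hv | ⟨hv, q, ⟨a, ha, haq⟩, hvq⟩
    · exact hstart p hp (hvp.exists_end (P := (· ∈ G.S)) hv)
    · exact ⟨a, ha, haq.tail ⟨v, hv, hvq, hvp⟩ hp⟩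
  have hend : ∀ p ∈ R, ∀ v, G.Incident v p.1 → v ∈ A := by
    intro p hp v hv
    simp only [A, Finset.mem_filter, Finset.mem_univ, true_and]
    by_cases hS : v ∈ G.S
    · exact .inl hS
    · refine .inr ⟨⟨hS, fun hT => hR p hp ?_⟩, p, hp, hv⟩
      exact hv.exists_end (P := (· ∈ G.T)) hT
  refine (h A hA).trans ?_
  have hcard : ∑ e with G.Crosses A e, k e =
      ((Finset.univ.filter (G.Crosses A)).sigma fun e => (Finset.univ : Finset (Fin (k e)))).card := by
    simp [Finset.card_sigma]
  rw [hcard]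
  refine Finset.card_le_card fun p hp => ?_
  simp only [Finset.mem_sigma, Finset.mem_filter, Finset.mem_univ, true_and, and_true] at hp
  by_contra hpW
  rcases hp with ⟨h1, h2⟩ | ⟨h1, h2⟩
  · exact h2 (hend p (hstep p hpW _ h1 (.inl rfl)) _ (.inr rfl))
  · exact h1 (hend p (hstep p hpW _ h2 (.inr rfl)) _ (.inl rfl))

theorem two_pow_le_R1 {k : G.E → ℕ} (hk : ∀ e, 2 ^ k e ≤ D e) {f : ℕ}
    (h : Linked (G.SlotAdj k) {p | G.IsSourceEdge p.1} {p | G.IsSinkEdge p.1} (Fin f)) :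
    2 ^ f ≤ G.R1 D := by
  classical
  obtain ⟨C, hC, h⟩ := h
  have hemb : ∀ e, Nonempty ((Fin (k e) → Bool) ↪ Fin (D e)) := fun e =>
    Function.Embedding.nonempty_of_card_le (by simpa using hk e)
  let ι : ∀ e, (Fin (k e) → Bool) ↪ Fin (D e) := fun e => (hemb e).some
  let bit : (Fin f → Bool) → (Σ e, Fin (k e)) → Bool := fun z p => ∃ m, p ∈ C m ∧ z m = true
  have hbit : ∀ z p m, p ∈ C m → bit z p = z m := by
    intro z p m hp
    have : (∃ m, p ∈ C m ∧ z m = true) ↔ z m = true :=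
      ⟨fun ⟨m', hm', hz⟩ => hC m' m p hm' hp ▸ hz, fun hz => ⟨m, hp, hz⟩⟩
    simp [bit, this]
  let F : (Fin f → Bool) → ∀ e, Fin (D e) := fun z e => ι e fun j => bit z ⟨e, j⟩
  have hF : ∀ z z' m, ∀ p ∈ C m, F z p.1 = F z' p.1 → z m = z' m := by
    rintro z z' m ⟨e, j⟩ hp hzz
    rw [← hbit z _ m hp, ← hbit z' _ m hp]
    exact congrFun ((ι e).injective hzz) j
  let 𝒯 : G.TensorAssignment D := fun u i => if ∃ z, ∀ e, i e = F z e.1 then 1 else 0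
  have hdiag : ∀ w z, G.contraction D 𝒯 (fun e => F w e.1) (fun e => F z e.1) ≠ 0 ↔ w = z := by
    intro w z
    let P : (∀ e, Fin (D e)) → Prop := fun i =>
      ∀ u : {v // G.Internal v}, ∃ y, ∀ e, G.Incident u.1 e → i e = F y e
    have hP : ∀ i : ∀ e, Fin (D e), (∏ u, 𝒯 u fun e => i e.1) = if P i then (1 : ℂ) else 0 := by
      intro i
      simp only [𝒯, Finset.prod_ite_zero, Finset.prod_const_one, P, Finset.mem_univ, true_imp_iff,
        Subtype.forall]
    have hsum : G.contraction D 𝒯 (fun e => F w e.1) (fun e => F z e.1) =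
        ((Finset.univ.filter fun i : (∀ e, Fin (D e)) =>
          ((∀ e : {e // G.IsSourceEdge e}, i e.1 = F z e.1) ∧
            (∀ e : {e // G.IsSinkEdge e}, i e.1 = F w e.1)) ∧ P i).card : ℂ) := by
      rw [contraction_apply, Finset.card_filter]
      push_cast
      refine Finset.sum_congr rfl fun i _ => ?_
      rw [hP, ← ite_and]
    rw [hsum, Nat.cast_ne_zero, Finset.card_ne_zero]
    constructor
    · rintro ⟨i, hi⟩
      obtain ⟨-, ⟨hz, hw⟩, hi⟩ := Finset.mem_filter.1 hi
      funext m
      obtain ⟨p, hp, q, hq, hpq⟩ := h m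
      obtain ⟨y, hy, hym⟩ : ∃ y, i q.1 = F y q.1 ∧ y m = z m := by
        refine hpq.induction_right (P := fun q => ∃ y, i q.1 = F y q.1 ∧ y m = z m)
          ⟨z, hz ⟨_, hp⟩, rfl⟩ ?_
        rintro r s hr ⟨u, hu, hur, hus⟩ hs ⟨y, hy, hym⟩
        obtain ⟨y', hy'⟩ := hi ⟨u, hu⟩
        refine ⟨y', hy' _ hus, ?_⟩
        rw [← hym]
        exact hF _ _ m r hr.mem_right ((hy' _ hur).symm.trans hy)
      rw [← hym]
      exact hF _ _ m q hpq.mem_right ((hw ⟨_, hq⟩).symm.trans hy)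
    · rintro rfl
      exact ⟨F w, Finset.mem_filter.2 ⟨Finset.mem_univ _, ⟨fun _ => rfl, fun _ => rfl⟩,
        fun _ => ⟨w, fun _ _ => rfl⟩⟩⟩
  refine le_trans ?_ (rank_le_R1 𝒯)
  refine le_trans ?_ ((G.contraction D 𝒯).rank_submatrix_le
    (fun w e => F w e.1) (fun z e => F z e.1))
  have hM : (G.contraction D 𝒯).submatrix (fun w e => F w e.1) (fun z e => F z e.1) =
      Matrix.diagonal fun z => G.contraction D 𝒯 (fun e => F z e.1) (fun e => F z e.1) := by
    ext w z
    by_cases hwz : w = z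
    · subst hwz
      simp
    · rw [Matrix.diagonal_apply_ne _ hwz, Matrix.submatrix_apply]
      exact not_not.1 (mt (hdiag w z).1 hwz)
  rw [hM, Matrix.rank_of_isUnit]
  · simp
  · rw [Matrix.isUnit_iff_isUnit_det, Matrix.det_diagonal, isUnit_iff_ne_zero]
    exact Finset.prod_ne_zero_iff.2 fun z _ => (hdiag z z).2 rfl

theorem MC_le_two_pow_mul_R1 (hD : ∀ e, 0 < D e) :
    G.MC D ≤ 2 ^ Fintype.card G.E * G.R1 D := by
  classical
  let k : G.E → ℕ := fun e => Nat.log 2 (D e)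
  let I : Set ℕ := {w | ∃ A : Finset G.V, G.IsCut A ∧ ∑ e with G.Crosses A e, k e = w}
  obtain ⟨A, hA, hAk⟩ : sInf I ∈ I := Nat.sInf_mem ⟨_, G.S, isCut_S, rfl⟩
  have hR := two_pow_le_R1 (D := D) (fun e => Nat.pow_log_le_self 2 (hD e).ne')
    (linked_slotAdj (k := k) (f := sInf I) fun B hB => Nat.sInf_le ⟨B, hB, rfl⟩)
  calc G.MC D ≤ ∏ e with G.Crosses A e, D e := MC_le hA
    _ ≤ ∏ e with G.Crosses A e, 2 * 2 ^ k e := by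
      refine Finset.prod_le_prod' fun e _ => ?_
      rw [← pow_succ']
      exact (Nat.lt_pow_succ_log_self one_lt_two _).le
    _ = 2 ^ (Finset.univ.filter (G.Crosses A)).card * 2 ^ sInf I := by
      rw [Finset.prod_mul_distrib, Finset.prod_const, Finset.prod_pow_eq_pow_sum, hAk]
    _ ≤ 2 ^ Fintype.card G.E * G.R1 D :=
      Nat.mul_le_mul (Nat.pow_le_pow_right two_pos (Finset.card_le_univ _)) hR

theorem MC_pow (d : G.E → ℕ) (n : ℕ) : G.MC (fun e => d e ^ n) = G.MC d ^ n := by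
  obtain ⟨A, hA, hAd⟩ := exists_cutValue_eq_MC d
  obtain ⟨B, hB, hBd⟩ := exists_cutValue_eq_MC fun e => d e ^ n
  refine le_antisymm ?_ ?_
  · rw [← hAd, ← cutValue_pow]
    exact MC_le hA
  · rw [← hBd, cutValue_pow]
    exact Nat.pow_le_pow_left (MC_le hB) n

theorem R1_le_MC (hD : ∀ e, 0 < D e) : G.R1 D ≤ G.MC D := by
  obtain ⟨A, hA, hAd⟩ := exists_cutValue_eq_MC D
  rw [← hAd]
  exact R1_le fun 𝒯 => rank_contraction_le_cutValue hD 𝒯 hA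

end NetShape

/-- the two-sided bound
`2^(-|E|) · MC(N)^n ≤ R1(N^⊠n) ≤ MC(N)^n` for every `n ≥ 1`, the lower bound
stated in `ℕ` as `MC(N)^n ≤ 2^|E| · R1(N^⊠n)`. -/
theorem stmt5 (G : NetShape) (d : G.E → ℕ) (hd : ∀ e, 2 ≤ d e)
    (n : ℕ) (hn : 1 ≤ n) :
    G.R1 (fun e => d e ^ n) ≤ (G.MC d) ^ n ∧
    (G.MC d) ^ n ≤ 2 ^ (Fintype.card G.E) * G.R1 (fun e => d e ^ n) := by
  have hD : ∀ e, 0 < d e ^ n := fun e => pow_pos (two_pos.trans_le (hd e)) n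
  rw [← NetShape.MC_pow]
  exact ⟨NetShape.R1_le_MC hD, NetShape.MC_le_two_pow_mul_R1 hD⟩
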